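/- Let G=(V,E) be a finite simple graph with |V| = n. Then μ(G) = 2 if and only if G has at least one edge and every connected component of G is a path graph (possibly a single vertex). -/

import Mathlib

open SimpleGraph

attribute [local instance] Classical.propDecidable

/-- Two vertices `u`, `v` of a set of points `P` are mutually visible in `G` if there is a
shortest `u,v`-path (a walk whose length equals the distance `G.dist u v`) none of whose
internal vertices lies in `P`. -/
def SimpleGraph.MutuallyVisible {V : Type*} (G : SimpleGraph V) (P : Set V) (u v : V) : Prop :=
  ∃ p : G.Walk u v, p.length = G.dist u v ∧ ∀ w ∈ p.support.tail.dropLast, w ∉ P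

/-- `P` is a mutual-visibility set of `G` if every two distinct points of `P`
are mutually visible. -/
def SimpleGraph.IsMVSet {V : Type*} (G : SimpleGraph V) (P : Set V) : Prop :=
  ∀ u ∈ P, ∀ v ∈ P, u ≠ v → G.MutuallyVisible P u v

/-- The mutual-visibility number `μ(G)`: the maximum cardinality of a
mutual-visibility set of `G`. -/
noncomputable def SimpleGraph.mutualVisibilityNumber {V : Type*} [Fintype V]
    (G : SimpleGraph V) : ℕ :=
  sSup {n | ∃ P : Set V, G.IsMVSet P ∧ P.ncard = n}

/-- A vertex set `S` is convex in `G` if every shortest path in `G` between two vertices of `S`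
has all of its vertices in `S`. -/
def SimpleGraph.IsConvexSet {V : Type*} (G : SimpleGraph V) (S : Set V) : Prop :=
  ∀ u ∈ S, ∀ v ∈ S, ∀ p : G.Walk u v, p.length = G.dist u v → ∀ w ∈ p.support, w ∈ S

/-- The convex hull of a set `A` of vertices: the smallest convex set containing `A`. -/
def SimpleGraph.convexHullSet {V : Type*} (G : SimpleGraph V) (A : Set V) : Set V :=
  ⋂₀ {S : Set V | G.IsConvexSet S ∧ A ⊆ S}

/-- `x` is an articulation vertex of `G` if deleting `x` increases the number of
connected components. -/
def SimpleGraph.IsArticulation {V : Type*} (G : SimpleGraph V) (x : V) : Prop :=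
  Nat.card G.ConnectedComponent < Nat.card (G.induce {x}ᶜ).ConnectedComponent

/-- `G` is a block graph if every 2-connected induced subgraph (an induced subgraph on at
least 3 vertices that is connected and remains connected after deleting any one vertex)
is complete. -/
def SimpleGraph.IsBlockGraph {V : Type*} (G : SimpleGraph V) : Prop :=
  ∀ S : Set V, 3 ≤ S.ncard → (G.induce S).Connected →
    (∀ x ∈ S, (G.induce (S \ {x})).Connected) →
    ∀ u ∈ S, ∀ v ∈ S, u ≠ v → G.Adj u v

/-- The join of two graphs: their disjoint union together with all edges between the
two vertex sets. -/
def SimpleGraph.joinGraph {V₁ V₂ : Type*} (G₁ : SimpleGraph V₁) (G₂ : SimpleGraph V₂) :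
    SimpleGraph (V₁ ⊕ V₂) :=
  (G₁ ⊕g G₂) ⊔ completeBipartiteGraph V₁ V₂

namespace SimpleGraph

variable {V : Type*} {G : SimpleGraph V} {P : Set V} {a b c u v w x : V}

theorem Walk.mem_interior_of_mem_support (p : G.Walk u v) (hw : w ∈ p.support)
    (hu : w ≠ u) (hv : w ≠ v) : w ∈ p.support.tail.dropLast := by
  have h₁ : w ∈ p.support.tail := by
    rw [← Walk.cons_tail_support] at hw
    exact (List.mem_cons.mp hw).resolve_left hu
  have hne : p.support.tail ≠ [] := List.ne_nil_of_mem h₁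
  have hlast : p.support.tail.getLast hne = v := by
    rw [List.getLast_tail, Walk.getLast_support]
  rw [← List.dropLast_append_getLast hne, List.mem_append, hlast, List.mem_singleton] at h₁
  exact h₁.resolve_right hv

theorem Walk.IsPath.mem_support_of_mem_interior {p : G.Walk u v} (hp : p.IsPath)
    (hw : w ∈ p.support.tail.dropLast) : w ∈ p.support ∧ w ≠ u ∧ w ≠ v := by
  have h₁ : w ∈ p.support.tail := List.mem_of_mem_dropLast hw
  have hnd := hp.support_nodup
  refine ⟨List.mem_of_mem_tail h₁, ?_, ?_⟩
  · rintro rfl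
    rw [← Walk.cons_tail_support, List.nodup_cons] at hnd
    exact hnd.1 h₁
  · rintro rfl
    have hne : p.support.tail ≠ [] := List.ne_nil_of_mem h₁
    have hlast : p.support.tail.getLast hne = w := by
      rw [List.getLast_tail, Walk.getLast_support]
    have hnt : p.support.tail.Nodup := hnd.sublist (List.tail_sublist _)
    rw [← List.dropLast_append_getLast hne, hlast] at hnt
    exact (List.disjoint_of_nodup_append hnt) hw (by simp)

theorem MutuallyVisible.symm (h : G.MutuallyVisible P u v) : G.MutuallyVisible P v u := by
  obtain ⟨p, hp, hP⟩ := h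
  refine ⟨p.reverse, by rw [Walk.length_reverse, hp, dist_comm], fun w hw => ?_⟩
  have hpath := p.reverse.isPath_of_length_eq_dist (by rw [Walk.length_reverse, hp, dist_comm])
  obtain ⟨hs, hv, hu⟩ := hpath.mem_support_of_mem_interior hw
  rw [Walk.support_reverse, List.mem_reverse] at hs
  exact hP w (p.mem_interior_of_mem_support hs hu hv)

theorem dist_add_dist_le_length (p : G.Walk u v) (hw : w ∈ p.support) :
    G.dist u w + G.dist w v ≤ p.length := by
  rw [← p.take_spec hw, Walk.length_append]
  exact add_le_add (dist_le _) (dist_le _)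

/-- A strict triangle inequality prevents a third point from blocking visibility. -/
theorem MutuallyVisible.of_dist_lt (h : G.Reachable a b)
    (hlt : G.dist a b < G.dist a c + G.dist c b) (hP : P ⊆ {a, b, c}) :
    G.MutuallyVisible P a b := by
  obtain ⟨p, hp⟩ := h.exists_walk_length_eq_dist
  refine ⟨p, hp, fun w hw hwP => ?_⟩
  obtain ⟨hs, ha, hb⟩ := (p.isPath_of_length_eq_dist hp).mem_support_of_mem_interior hw
  obtain rfl : w = c := by
    rcases hP hwP with h | h | h
    exacts [absurd h ha, absurd h hb, h]
  have := dist_add_dist_le_length p hs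
  omega

theorem MutuallyVisible.of_adj (h : G.Adj a b) : G.MutuallyVisible P a b :=
  ⟨h.toWalk, by simp [dist_eq_one_iff_adj.mpr h], by simp⟩

theorem MutuallyVisible.of_adj_adj (hax : G.Adj a x) (hxb : G.Adj x b) (hab : a ≠ b)
    (hx : x ∉ P) : G.MutuallyVisible P a b := by
  by_cases h : G.Adj a b
  · exact .of_adj h
  · let p : G.Walk a b := .cons hax (.cons hxb .nil)
    refine ⟨p, ?_, by simpa [p] using hx⟩
    have h₁ := dist_le p
    have h₂ := p.reachable.one_lt_dist_of_ne_of_not_adj hab h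
    have h₃ : p.length = 2 := rfl
    omega

theorem IsMVSet.of_triple (hab : G.MutuallyVisible {a, b, c} a b)
    (hac : G.MutuallyVisible {a, b, c} a c) (hbc : G.MutuallyVisible {a, b, c} b c) :
    G.IsMVSet {a, b, c} := by
  rintro u (rfl | rfl | rfl) v (rfl | rfl | rfl) huv
  all_goals first
    | exact absurd rfl huv
    | assumption
    | exact MutuallyVisible.symm (by assumption)

theorem IsMVSet.of_claw (ha : G.Adj x a) (hb : G.Adj x b) (hc : G.Adj x c)
    (hab : a ≠ b) (hac : a ≠ c) (hbc : b ≠ c) : G.IsMVSet {a, b, c} := by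
  have hx : x ∉ ({a, b, c} : Set V) := by
    rintro (h | h | h)
    exacts [ha.ne h, hb.ne h, hc.ne h]
  exact .of_triple (.of_adj_adj ha.symm hb hab hx) (.of_adj_adj ha.symm hc hac hx)
    (.of_adj_adj hb.symm hc hbc hx)

/-- A second neighbour of an endpoint of a diametral geodesic yields a mutual-visibility set of
size three. -/
theorem exists_isMVSet_triple_of_adj_end (hmax : G.dist w v ≤ G.dist u v) (hw : G.Adj u w)
    (hx : G.Adj u x) (hxv : G.dist u v = G.dist x v + 1) (hr : G.Reachable u v)
    (hwx : w ≠ x) (hwv : w ≠ v) :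
    ∃ a b c, a ≠ b ∧ a ≠ c ∧ b ≠ c ∧ G.IsMVSet {a, b, c} := by
  have huw : G.dist u w = 1 := dist_eq_one_iff_adj.mpr hw
  have hwu : G.dist w u = 1 := dist_eq_one_iff_adj.mpr hw.symm
  have huv : u ≠ v := by rintro rfl; simp at hxv
  have hrw : G.Reachable w v := hw.symm.reachable.trans hr
  have hwpos := hrw.pos_dist_of_ne hwv
  have hle := hw.reachable.dist_triangle_left v
  have hvw : G.dist v w = G.dist w v := dist_comm
  rcases hmax.eq_or_lt with heq | hlt
  · exact ⟨w, u, v, hw.ne', hwv, huv, .of_triple (.of_adj hw.symm)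
      (.of_dist_lt hrw (c := u) (by omega) (by intro; simp; tauto))
      (.of_dist_lt hr (c := w) (by omega) (by intro; simp; tauto))⟩
  · have hrx : G.Reachable x v := hx.symm.reachable.trans hr
    have hxv' : x ≠ v := by
      rintro rfl
      rw [dist_self] at hxv
      omega
    have hxw := (hw.symm.reachable.trans hx.reachable).pos_dist_of_ne hwx
    have hcomm : G.dist x w = G.dist w x := dist_comm
    refine ⟨w, x, v, hwx, hwv, hxv', .of_triple (.of_adj_adj hw.symm hx hwx ?_)
      (.of_dist_lt hrw (c := x) (by omega) (by intro; simp; tauto))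
      (.of_dist_lt hrx (c := w) (by omega) (by intro; simp; tauto))⟩
    rintro (h | h | h)
    exacts [hw.ne h, hx.ne h, huv h]

theorem Walk.dist_getVert {p : G.Walk u v} (hp : p.length = G.dist u v) {i j : ℕ} (hij : i ≤ j)
    (hj : j ≤ p.length) : G.dist (p.getVert i) (p.getVert j) = j - i := by
  let q := (p.drop i).take (j - i)
  have hq : q.length = j - i := by simp [q, Walk.take_length, Walk.drop_length]; omega
  have hend : (p.drop i).getVert (j - i) = p.getVert j := by
    rw [Walk.drop_getVert]; congr 1; omega
  have h₁ : G.dist (p.getVert i) (p.getVert j) ≤ j - i := by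
    rw [← hend]; exact (dist_le q).trans_eq hq
  have h₂ : G.dist u (p.getVert i) ≤ i := (dist_le (p.take i)).trans (by simp [Walk.take_length])
  have h₃ : G.dist (p.getVert j) v ≤ p.length - j :=
    (dist_le (p.drop j)).trans (by simp [Walk.drop_length])
  have h₄ := (p.take i).reachable.dist_triangle_left v
  have h₅ := (p.drop j).reachable.dist_triangle_right (p.getVert i)
  omega

/-- A diametral geodesic covers its component, unless there is a mutual-visibility set of size
three. -/
theorem Walk.mem_support_of_no_isMVSet_triple (p : G.Walk u v) (hp : p.length = G.dist u v)
    (hmax : ∀ x y, G.Reachable u x → G.Reachable u y → G.dist x y ≤ G.dist u v)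
    (hG : ¬ ∃ a b c, a ≠ b ∧ a ≠ c ∧ b ≠ c ∧ G.IsMVSet {a, b, c})
    (hw : G.Reachable u w) : w ∈ p.support := by
  by_contra hwp
  obtain ⟨q⟩ := hw
  obtain ⟨d, -, hd₁, hd₂⟩ := q.exists_boundary_dart {x | x ∈ p.support} p.start_mem_support hwp
  obtain ⟨⟨y, z⟩, hyz⟩ := d
  change y ∈ p.support at hd₁
  change z ∉ p.support at hd₂
  change G.Adj y z at hyz
  have hz : ∀ i, p.getVert i ≠ z := fun i h => hd₂ (h ▸ p.getVert_mem_support i)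
  have huz : G.Reachable u z := (p.takeUntil y hd₁).reachable.trans hyz.reachable
  obtain ⟨i, rfl, hi⟩ := Walk.mem_support_iff_exists_getVert.mp hd₁
  have hpos : 0 < p.length := by
    rw [hp]
    rcases eq_or_ne u v with rfl | h
    · have h := hmax _ _ ((p.take i).reachable) huz
      rw [dist_eq_one_iff_adj.mpr hyz] at h
      exact h
    · exact p.reachable.pos_dist_of_ne h
  rcases Nat.eq_zero_or_pos i with rfl | hi₀
  · rw [Walk.getVert_zero] at hyz
    refine hG (exists_isMVSet_triple_of_adj_end (x := p.getVert 1)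
      (hmax _ _ huz p.reachable) hyz ?_ ?_ p.reachable (hz 1).symm ?_)
    · simpa using p.adj_getVert_succ hpos
    · have := p.dist_getVert hp (i := 1) hpos le_rfl
      rw [Walk.getVert_length] at this
      omega
    · simpa using (hz p.length).symm
  rcases hi.eq_or_lt with rfl | hi₁
  · rw [Walk.getVert_length] at hyz
    refine hG (exists_isMVSet_triple_of_adj_end (u := v) (v := u) (x := p.getVert (p.length - 1))
      ?_ hyz ?_ ?_ p.reachable.symm (hz _).symm ?_)
    · rw [dist_comm (u := v)]
      exact hmax _ _ huz (.refl _)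
    · have := p.adj_getVert_succ (i := p.length - 1) (by omega)
      rw [Nat.sub_add_cancel hpos, Walk.getVert_length] at this
      exact this.symm
    · have := p.dist_getVert hp (Nat.zero_le (p.length - 1)) (by omega)
      rw [Walk.getVert_zero] at this
      rw [dist_comm (u := v), dist_comm (v := u)]
      omega
    · simpa using (hz 0).symm
  · have hprev := p.adj_getVert_succ (i := i - 1) (by omega)
    rw [Nat.sub_add_cancel hi₀] at hprev
    have hnext := p.adj_getVert_succ hi₁
    have hne : p.getVert (i - 1) ≠ p.getVert (i + 1) := by
      intro h
      have := p.dist_getVert hp (i := i - 1) (j := i + 1) (by omega) (by omega)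
      rw [h, dist_self] at this
      omega
    exact hG ⟨_, _, _, hne, hz _, hz _, .of_claw hprev.symm hnext hyz hne (hz _) (hz _)⟩

theorem nonempty_induce_supp_iso_pathGraph [Finite V]
    (hG : ¬ ∃ a b c, a ≠ b ∧ a ≠ c ∧ b ≠ c ∧ G.IsMVSet {a, b, c}) (C : G.ConnectedComponent) :
    ∃ k, Nonempty (G.induce C.supp ≃g pathGraph k) := by
  have : Nonempty C.supp := C.nonempty_supp.to_subtype
  obtain ⟨⟨⟨u, hu⟩, ⟨v, hv⟩⟩, hmax⟩ :=
    Finite.exists_max fun q : C.supp × C.supp => G.dist q.1 q.2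
  have hsupp : ∀ x, x ∈ C.supp ↔ G.Reachable u x := fun x => by
    rw [ConnectedComponent.mem_supp_iff] at hu ⊢
    rw [← hu, ConnectedComponent.eq, reachable_comm]
  obtain ⟨p, hp⟩ := ((hsupp v).mp hv).exists_walk_length_eq_dist
  have hcover : ∀ w, G.Reachable u w → w ∈ p.support := fun w =>
    p.mem_support_of_no_isMVSet_triple hp (fun x y hx hy =>
      hmax (⟨x, (hsupp x).mpr hx⟩, ⟨y, (hsupp y).mpr hy⟩)) hG
  let f : Fin (p.length + 1) → C.supp := fun i =>
    ⟨p.getVert i, (hsupp _).mpr (p.take i).reachable⟩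
  have hinj : Function.Injective f := by
    intro i j hij
    have hij : p.getVert i = p.getVert j := congrArg Subtype.val hij
    rcases le_total i j with h | h
    · have := p.dist_getVert hp (i := i) (j := j) h (by omega)
      rw [hij, dist_self] at this
      omega
    · have := p.dist_getVert hp (i := j) (j := i) h (by omega)
      rw [hij, dist_self] at this
      omega
  have hsurj : Function.Surjective f := by
    rintro ⟨w, hw⟩
    obtain ⟨i, hi, hle⟩ := Walk.mem_support_iff_exists_getVert.mp (hcover w ((hsupp w).mp hw))
    exact ⟨⟨i, by omega⟩, Subtype.ext hi⟩
  let e : pathGraph (p.length + 1) ≃g G.induce C.supp :=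
    { toEquiv := Equiv.ofBijective f ⟨hinj, hsurj⟩
      map_rel_iff' := by
        intro i j
        rw [pathGraph_adj]
        change G.Adj (p.getVert i) (p.getVert j) ↔ _
        rw [← dist_eq_one_iff_adj]
        rcases le_total i j with h | h
        · rw [p.dist_getVert hp (i := i) (j := j) h (by omega)]
          omega
        · rw [dist_comm, p.dist_getVert hp (i := j) (j := i) h (by omega)]
          omega }
  exact ⟨_, ⟨e.symm⟩⟩

/-- In a component which is a path, a point between two others blocks their visibility. -/
theorem not_mutuallyVisible_of_between {C : G.ConnectedComponent} {k : ℕ}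
    (e : G.induce C.supp ≃g pathGraph k) {a b c : C.supp} (hab : e a < e b) (hbc : e b < e c)
    (hb : (b : V) ∈ P) : ¬ G.MutuallyVisible P a c := by
  rintro ⟨p, -, hP⟩
  obtain ⟨d, hd, ⟨hxC, hx⟩, hy⟩ := p.exists_boundary_dart
    {x | ∃ h : x ∈ C.supp, e ⟨x, h⟩ < e b} ⟨a.2, hab⟩ (fun ⟨_, h⟩ => (h.trans hbc).false)
  have hyC : d.snd ∈ C.supp := C.mem_supp_of_adj_mem_supp hxC d.adj
  have hle : e b ≤ e ⟨d.snd, hyC⟩ := not_lt.mp fun h => hy ⟨hyC, h⟩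
  have hadj : (pathGraph k).Adj (e ⟨d.fst, hxC⟩) (e ⟨d.snd, hyC⟩) := e.map_rel_iff.mpr d.adj
  rw [pathGraph_adj] at hadj
  have heq : e b = e ⟨d.snd, hyC⟩ := by omega
  have hbd : (b : V) = d.snd := congrArg Subtype.val (e.injective heq)
  refine hP b (p.mem_interior_of_mem_support (hbd ▸ p.dart_snd_mem_support_of_mem_darts hd) ?_ ?_) hb
  · intro h
    rw [Subtype.ext h] at hab
    exact hab.false
  · intro h
    rw [Subtype.ext h] at hbc
    exact hbc.false

theorem IsMVSet.ncard_le_two [Finite V] (hP : G.IsMVSet P)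
    (hG : ∀ C : G.ConnectedComponent, ∃ k, Nonempty (G.induce C.supp ≃g pathGraph k)) :
    P.ncard ≤ 2 := by
  by_contra! hcard
  obtain ⟨a, ha, b, hb, c, hc, hab, hac, hbc⟩ := (Set.two_lt_ncard).mp hcard
  obtain ⟨k, ⟨e⟩⟩ := hG (G.connectedComponentMk a)
  have mem : ∀ x ∈ P, x ∈ (G.connectedComponentMk a).supp := by
    intro x hx
    rw [ConnectedComponent.mem_supp_iff, ConnectedComponent.eq]
    rcases eq_or_ne x a with rfl | h
    · rfl
    · obtain ⟨p, -⟩ := hP x hx a ha h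
      exact p.reachable
  have key : ∀ x y z : (G.connectedComponentMk a).supp, (x : V) ∈ P → (y : V) ∈ P → (z : V) ∈ P →
      e x < e y → e y < e z → False := fun x y z hx hy hz hxy hyz =>
    not_mutuallyVisible_of_between e hxy hyz hy (hP _ hx _ hz fun h => by
      rw [Subtype.ext h] at hxy
      exact (hxy.trans hyz).false)
  have ne : ∀ x y (hx : x ∈ P) (hy : y ∈ P), x ≠ y → e ⟨x, mem x hx⟩ ≠ e ⟨y, mem y hy⟩ :=
    fun x y hx hy hxy h => hxy (congrArg Subtype.val (e.injective h))
  have h₁ := ne a b ha hb hab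
  have h₂ := ne a c ha hc hac
  have h₃ := ne b c hb hc hbc
  rcases h₁.lt_or_gt with h₁ | h₁ <;> rcases h₂.lt_or_gt with h₂ | h₂ <;>
    rcases h₃.lt_or_gt with h₃ | h₃ <;>
    first
    | exact key _ _ _ ha hb hc h₁ h₃
    | exact key _ _ _ ha hc hb h₂ h₃
    | exact key _ _ _ hb ha hc h₁ h₂
    | exact key _ _ _ hb hc ha h₃ h₂
    | exact key _ _ _ hc ha hb h₂ h₁
    | exact key _ _ _ hc hb ha h₃ h₁

theorem bddAbove_ncard_isMVSet [Finite V] (G : SimpleGraph V) :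
    BddAbove {n | ∃ P : Set V, G.IsMVSet P ∧ P.ncard = n} :=
  ⟨Nat.card V, by rintro _ ⟨P, -, rfl⟩; exact Set.ncard_le_card P⟩

theorem IsMVSet.ncard_le_mutualVisibilityNumber [Fintype V] (hP : G.IsMVSet P) :
    P.ncard ≤ G.mutualVisibilityNumber :=
  le_csSup G.bddAbove_ncard_isMVSet ⟨P, hP, rfl⟩

theorem exists_isMVSet_ncard_eq_mutualVisibilityNumber [Fintype V] (G : SimpleGraph V) :
    ∃ P : Set V, G.IsMVSet P ∧ P.ncard = G.mutualVisibilityNumber :=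
  Nat.sSup_mem (s := {n | ∃ P : Set V, G.IsMVSet P ∧ P.ncard = n})
    ⟨0, ∅, by simp [IsMVSet], Set.ncard_empty V⟩ G.bddAbove_ncard_isMVSet

end SimpleGraph

theorem mu_eq_two_iff {V : Type*} [Fintype V] (G : SimpleGraph V) :
    G.mutualVisibilityNumber = 2 ↔
      (∃ u v : V, G.Adj u v) ∧
        ∀ c : G.ConnectedComponent,
          ∃ k : ℕ, Nonempty ((G.induce c.supp) ≃g pathGraph k) := by
  obtain ⟨P, hP, hcard⟩ := G.exists_isMVSet_ncard_eq_mutualVisibilityNumber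
  constructor
  · intro h
    constructor
    · obtain ⟨u, v, huv, rfl⟩ := Set.ncard_eq_two.mp (hcard.trans h)
      obtain ⟨p, -⟩ := hP u (by simp) v (by simp) huv
      exact ⟨_, _, p.adj_snd (Walk.not_nil_of_ne huv)⟩
    · refine fun c => nonempty_induce_supp_iso_pathGraph ?_ c
      rintro ⟨x, y, z, hxy, hxz, hyz, hM⟩
      have := hM.ncard_le_mutualVisibilityNumber
      rw [Set.ncard_eq_three.mpr ⟨x, y, z, hxy, hxz, hyz, rfl⟩] at this
      omega
  · rintro ⟨⟨u, v, huv⟩, hG⟩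
    refine le_antisymm (hcard ▸ hP.ncard_le_two hG) ?_
    rw [← Set.ncard_pair huv.ne]
    refine IsMVSet.ncard_le_mutualVisibilityNumber ?_
    rintro x (rfl | rfl) y (rfl | rfl) hxy
    exacts [absurd rfl hxy, .of_adj huv, .of_adj huv.symm, absurd rfl hxy]
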